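/- arXiv:2007.15370 — 2 statements merged into one kernel-verified Lean document; each statement's English description precedes it below -/
import Mathlib

section
/- Fix s > 0 and define G^s : ℝ² → ℝ by G^s(x) = ∫₀^∞ (4πt)^(−1) · exp(−‖x‖²/(4t) − s·t) dt. Then G^s is integrable on ℝ², and for every ξ ∈ ℝ² its Fourier transform satisfies ∫_{ℝ²} G^s(x) · exp(−2πi⟨x,ξ⟩) dx = 1/(4π²‖ξ‖² + s). -/
open MeasureTheory Real Complex

lemma rk_gauss (s t : ℝ) (ht : 0 < t) (ξ : EuclideanSpace ℝ (Fin 2)) :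
    Integrable (fun x : EuclideanSpace ℝ (Fin 2) =>
      (((4 * Real.pi * t)⁻¹ * Real.exp (-‖x‖ ^ 2 / (4 * t) - s * t) : ℝ) : ℂ) *
          Complex.exp (-2 * Real.pi * Complex.I * ((inner ℝ x ξ : ℝ) : ℂ))) ∧
    ∫ x : EuclideanSpace ℝ (Fin 2),
      (((4 * Real.pi * t)⁻¹ * Real.exp (-‖x‖ ^ 2 / (4 * t) - s * t) : ℝ) : ℂ) *
          Complex.exp (-2 * Real.pi * Complex.I * ((inner ℝ x ξ : ℝ) : ℂ))
      = ((Real.exp (-(4 * Real.pi ^ 2 * ‖ξ‖ ^ 2 + s) * t) : ℝ) : ℂ) := by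
  have htc : (t : ℂ) ≠ 0 := by exact_mod_cast ht.ne'
  have hpc : (Real.pi : ℂ) ≠ 0 := by exact_mod_cast Real.pi_ne_zero
  have hb : 0 < ((((4 * t)⁻¹ : ℝ)) : ℂ).re := by
    rw [Complex.ofReal_re]; positivity
  have hfun : (fun x : EuclideanSpace ℝ (Fin 2) =>
      (((4 * Real.pi * t)⁻¹ * Real.exp (-‖x‖ ^ 2 / (4 * t) - s * t) : ℝ) : ℂ) *
          Complex.exp (-2 * Real.pi * Complex.I * ((inner ℝ x ξ : ℝ) : ℂ)))
      = fun x => (((4 * Real.pi * t)⁻¹ * Real.exp (- s * t) : ℝ) : ℂ) *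
        Complex.exp (-(((4 * t)⁻¹ : ℝ) : ℂ) * ‖x‖ ^ 2 +
          (-2 * Real.pi * Complex.I) * ((inner ℝ ξ x : ℝ) : ℂ)) := by
    funext x
    rw [real_inner_comm]
    push_cast
    rw [mul_assoc (_⁻¹) (cexp _) _, mul_assoc (_⁻¹) (cexp _) _, ← Complex.exp_add, ← Complex.exp_add]
    congr 2
    field_simp
    ring
  rw [hfun]
  constructor
  · exact (GaussianFourier.integrable_cexp_neg_mul_sq_norm_add hb _ ξ).const_mul _
  · rw [integral_const_mul, GaussianFourier.integral_cexp_neg_mul_sq_norm_add hb]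
    have h1 : ((Module.finrank ℝ (EuclideanSpace ℝ (Fin 2)) : ℂ) / 2) = 1 := by simp
    rw [h1, Complex.cpow_one]
    push_cast
    have h2 : (-2 * (Real.pi : ℂ) * Complex.I) ^ 2 * (‖ξ‖ : ℂ) ^ 2 / (4 * (4 * (t : ℂ))⁻¹)
        = - (4 * Real.pi ^ 2 * ‖ξ‖ ^ 2) * t := by
      rw [mul_pow, Complex.I_sq]
      field_simp
      ring
    rw [h2, show (-(4 * (Real.pi : ℂ) ^ 2 * ‖ξ‖ ^ 2 + s) * t)
      = -s * t + - (4 * Real.pi ^ 2 * ‖ξ‖ ^ 2) * t by ring, Complex.exp_add]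
    field_simp

lemma rk_integrable (s : ℝ) (hs : 0 < s) :
    Integrable (fun p : EuclideanSpace ℝ (Fin 2) × ℝ =>
      (4 * Real.pi * p.2)⁻¹ * Real.exp (-‖p.1‖ ^ 2 / (4 * p.2) - s * p.2))
      ((volume : Measure (EuclideanSpace ℝ (Fin 2))).prod (volume.restrict (Set.Ioi (0:ℝ)))) := by
  have hm : Measurable (fun p : EuclideanSpace ℝ (Fin 2) × ℝ =>
      (4 * Real.pi * p.2)⁻¹ * Real.exp (-‖p.1‖ ^ 2 / (4 * p.2) - s * p.2)) := by
    fun_prop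
  have key : ∀ t : ℝ, 0 < t → Integrable (fun x : EuclideanSpace ℝ (Fin 2) =>
      (4 * Real.pi * t)⁻¹ * Real.exp (-‖x‖ ^ 2 / (4 * t) - s * t)) ∧
      ∫ x : EuclideanSpace ℝ (Fin 2),
        (4 * Real.pi * t)⁻¹ * Real.exp (-‖x‖ ^ 2 / (4 * t) - s * t) = Real.exp (-s * t) := by
    intro t ht
    obtain ⟨h1, h2⟩ := rk_gauss s t ht 0
    simp only [inner_zero_right, Complex.ofReal_zero, mul_zero, Complex.exp_zero, mul_one] at h1 h2
    constructor
    · exact h1.re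
    · rw [integral_complex_ofReal, Complex.ofReal_inj] at h2
      rw [h2]; simp
  rw [integrable_prod_iff' hm.aestronglyMeasurable]
  constructor
  · filter_upwards [ae_restrict_mem measurableSet_Ioi] with t ht
    exact (key t ht).1
  · have hexp : Integrable (fun t : ℝ => Real.exp (-s * t)) (volume.restrict (Set.Ioi 0)) :=
      integrableOn_exp_mul_Ioi (neg_neg_of_pos hs) 0
    refine hexp.congr ?_
    filter_upwards [ae_restrict_mem measurableSet_Ioi] with t ht
    have ht' : 0 < t := ht
    rw [← (key t ht).2]
    refine integral_congr_ae (Filter.Eventually.of_forall fun x => ?_)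
    have : 0 ≤ (4 * Real.pi * t)⁻¹ * Real.exp (-‖x‖ ^ 2 / (4 * t) - s * t) := by positivity
    exact (Real.norm_of_nonneg this).symm

/-- **Fourier transform of the resolvent kernel.**
For `s > 0`, the function `G^s(x) = ∫₀^∞ (4πt)⁻¹ exp(−‖x‖²/(4t) − s t) dt` is integrable on
`ℝ²`, and for every `ξ ∈ ℝ²` its Fourier transform equals `1/(4π²‖ξ‖² + s)`. -/
theorem resolvent_kernel_fourier (s : ℝ) (hs : 0 < s) :
    MeasureTheory.Integrable
      (fun x : EuclideanSpace ℝ (Fin 2) =>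
        ∫ t in Set.Ioi (0 : ℝ), (4 * Real.pi * t)⁻¹ * Real.exp (-‖x‖ ^ 2 / (4 * t) - s * t)) ∧
    ∀ ξ : EuclideanSpace ℝ (Fin 2),
      (∫ x : EuclideanSpace ℝ (Fin 2),
        ((∫ t in Set.Ioi (0 : ℝ),
            (4 * Real.pi * t)⁻¹ * Real.exp (-‖x‖ ^ 2 / (4 * t) - s * t) : ℝ) : ℂ) *
          Complex.exp (-2 * Real.pi * Complex.I * ((inner ℝ x ξ : ℝ) : ℂ)))
      = ((1 / (4 * Real.pi ^ 2 * ‖ξ‖ ^ 2 + s) : ℝ) : ℂ) := by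
  have hKint := rk_integrable s hs
  refine ⟨hKint.integral_prod_left, fun ξ => ?_⟩
  have hF : Integrable (Function.uncurry fun (x : EuclideanSpace ℝ (Fin 2)) (t : ℝ) =>
      (((4 * Real.pi * t)⁻¹ * Real.exp (-‖x‖ ^ 2 / (4 * t) - s * t) : ℝ) : ℂ) *
          Complex.exp (-2 * Real.pi * Complex.I * ((inner ℝ x ξ : ℝ) : ℂ)))
      ((volume : Measure (EuclideanSpace ℝ (Fin 2))).prod (volume.restrict (Set.Ioi (0:ℝ)))) := by
    refine hKint.norm.mono' ?_ (Filter.Eventually.of_forall fun p => ?_)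
    · apply Measurable.aestronglyMeasurable
      unfold Function.uncurry
      fun_prop
    · simp only [Function.uncurry]
      rw [norm_mul, Complex.norm_real, show (-2 * Real.pi * Complex.I * ((inner ℝ p.1 ξ : ℝ) : ℂ))
        = ((-2 * Real.pi * inner ℝ p.1 ξ : ℝ) : ℂ) * Complex.I by push_cast; ring,
        Complex.norm_exp_ofReal_mul_I, mul_one]
  have hpos : 0 < 4 * Real.pi ^ 2 * ‖ξ‖ ^ 2 + s := by positivity
  simp_rw [← integral_complex_ofReal, ← integral_mul_const]
  rw [integral_integral_swap hF,
    setIntegral_congr_fun measurableSet_Ioi (fun t ht => (rk_gauss s t ht ξ).2),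
    integral_complex_ofReal, integral_exp_mul_Ioi (neg_neg_of_pos hpos) 0]
  congr 1
  rw [mul_zero, Real.exp_zero, neg_div_neg_eq]
end

section
/- Let p ∈ (1,2] be real. There exists a constant C > 0 such that for all complex numbers z ≠ 0 and all w ∈ ℂ, | |z+w|^(p−1)(z+w) − |z|^(p−1)z − ((p+1)/2)·|z|^(p−1)·w − ((p−1)/2)·|z|^(p−3)·z²·conj(w) | ≤ C·|w|^p. -/
open Complex

lemma aux_bern (a t : ℝ) (ha : 0 < a) (ha1 : a ≤ 1) (ht : -1 ≤ t) :
    |(1 + t) ^ a - 1 - a * t| ≤ t ^ 2 := by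
  have h1 : (1 + t) ^ a ≤ 1 + a * t := rpow_one_add_le_one_add_mul_self ht ha.le ha1
  have h2 : (1 + t) ^ (1 - a) ≤ 1 + (1 - a) * t :=
    rpow_one_add_le_one_add_mul_self ht (by linarith) (by linarith)
  have hmul : (1 + t) ^ a * (1 + t) ^ (1 - a) = 1 + t := by
    rw [← Real.rpow_add_of_nonneg (by linarith) ha.le (by linarith)]
    norm_num
  have h0 : 0 ≤ (1 + t) ^ a := Real.rpow_nonneg (by linarith) _
  have hd : a ≤ 1 + (1 - a) * t := by nlinarith
  have h3 : 1 + t ≤ (1 + t) ^ a * (1 + (1 - a) * t) := by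
    calc 1 + t = (1 + t) ^ a * (1 + t) ^ (1 - a) := hmul.symm
      _ ≤ _ := by gcongr
  have h4 : 1 + a * t - t ^ 2 ≤ (1 + t) ^ a := by
    have h5 : (1 + a * t - t ^ 2) * (1 + (1 - a) * t) ≤ (1 + t) ^ a * (1 + (1 - a) * t) := by
      refine le_trans ?_ h3
      have e : (1 + t) - (1 + a * t - t ^ 2) * (1 + (1 - a) * t)
          = t ^ 2 * ((1 + (1 - a) * t) - a * (1 - a)) := by ring
      have : 0 ≤ t ^ 2 * ((1 + (1 - a) * t) - a * (1 - a)) := by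
        apply mul_nonneg (sq_nonneg _)
        nlinarith
      linarith
    exact le_of_mul_le_mul_right h5 (by linarith)
  rw [abs_le]
  constructor <;> nlinarith [sq_nonneg t]

lemma aux_holder_le (a s r h : ℝ) (ha : 0 < a) (ha1 : a ≤ 1) (hr : 0 ≤ r) (hs : 0 ≤ s)
    (hh : 0 ≤ h) (hsr : s - r ≤ h) : s ^ a - r ^ a ≤ h ^ a := by
  have h1 : s ^ a ≤ (r + h) ^ a := Real.rpow_le_rpow hs (by linarith) ha.le
  have h2 := Real.rpow_add_le_add_rpow hr hh ha.le ha1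
  linarith

lemma aux_real (a r s h c : ℝ) (ha : 0 < a) (ha1 : a ≤ 1) (hr : 0 < r) (hs : 0 ≤ s)
    (hh : 0 < h) (hhr : h ≤ r) (hsr : |s - r| ≤ h) (hc : 2 * c = s ^ 2 - r ^ 2 - h ^ 2) :
    |s ^ a - r ^ a - a * (r ^ a / r ^ 2) * c| * r ≤ 3 / 2 * (h ^ a * h) := by
  have hR : 0 < r ^ a := Real.rpow_pos_of_pos hr a
  have hH : 0 < h ^ a := Real.rpow_pos_of_pos hh a
  have hk : r ^ a * h ≤ r * h ^ a := by
    have e1 : h = h ^ a * h ^ (1 - a) := by rw [← Real.rpow_add hh]; norm_num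
    have e2 : r = r ^ a * r ^ (1 - a) := by rw [← Real.rpow_add hr]; norm_num
    have h3 : h ^ (1 - a) ≤ r ^ (1 - a) := Real.rpow_le_rpow hh.le hhr (by linarith)
    calc r ^ a * h = (r ^ a * h ^ a) * h ^ (1 - a) := by nth_rewrite 1 [e1]; ring
      _ ≤ (r ^ a * h ^ a) * r ^ (1 - a) := by gcongr
      _ = (r ^ a * r ^ (1 - a)) * h ^ a := by ring
      _ = r * h ^ a := by rw [← e2]
  obtain ⟨t, rfl⟩ : ∃ t, s = r * (1 + t) := ⟨s / r - 1, by field_simp; ring⟩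
  obtain ⟨y, rfl⟩ : ∃ y, h = r * y := ⟨h / r, by field_simp⟩
  have ht : -1 ≤ t := by
    have := nonneg_of_mul_nonneg_right hs hr
    linarith
  have hb := aux_bern a t ha ha1 ht
  have hty : |t| ≤ y := by
    have : r * (1 + t) - r = r * t := by ring
    rw [this, abs_mul, abs_of_pos hr] at hsr
    exact le_of_mul_le_mul_left hsr hr
  have ht2 : t ^ 2 ≤ y ^ 2 := by
    rw [← sq_abs t]; gcongr
  rw [Real.mul_rpow hr.le (by linarith)]
  have hc' : c = r ^ 2 * (t + (t ^ 2 - y ^ 2) / 2) := by linarith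
  have e : r ^ a * (1 + t) ^ a - r ^ a - a * (r ^ a / r ^ 2) * c
      = r ^ a * (((1 + t) ^ a - 1 - a * t) - a * ((t ^ 2 - y ^ 2) / 2)) := by
    rw [hc']; field_simp; ring
  have hin : |((1 + t) ^ a - 1 - a * t) - a * ((t ^ 2 - y ^ 2) / 2)| ≤ 3 / 2 * y ^ 2 := by
    rw [abs_le] at hb ⊢
    have h1 : a * (y ^ 2 - t ^ 2) ≤ y ^ 2 := by nlinarith [sq_nonneg t]
    have h2 : 0 ≤ a * (y ^ 2 - t ^ 2) := mul_nonneg ha.le (by linarith)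
    constructor <;> linarith
  rw [e, abs_mul, abs_of_pos hR]
  have hy : 0 ≤ y := le_trans (abs_nonneg _) hty
  calc r ^ a * |((1 + t) ^ a - 1 - a * t) - a * ((t ^ 2 - y ^ 2) / 2)| * r
      ≤ r ^ a * (3 / 2 * y ^ 2) * r := by gcongr
    _ = 3 / 2 * y * (r ^ a * (r * y)) := by ring
    _ ≤ 3 / 2 * y * (r * (r * y) ^ a) := by gcongr
    _ = _ := by ring

/-- **Pointwise Taylor estimate for the nonlinearity `g(z) = |z|^(p-1) z`, `1 < p ≤ 2`.**
There exists `C > 0` such that for all `z ≠ 0` and all `w`,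
`|g(z+w) − g(z) − ((p+1)/2)|z|^(p−1) w − ((p−1)/2)|z|^(p−3) z² conj w| ≤ C |w|^p`. -/
theorem nonlinearity_taylor_estimate (p : ℝ) (hp : p ∈ Set.Ioc (1 : ℝ) 2) :
    ∃ C : ℝ, 0 < C ∧ ∀ z w : ℂ, z ≠ 0 →
      ‖
        ((‖z + w‖ ^ (p - 1) : ℝ) * (z + w)
          - (‖z‖ ^ (p - 1) : ℝ) * z
          - (((p + 1) / 2 * ‖z‖ ^ (p - 1) : ℝ) : ℂ) * w
          - (((p - 1) / 2 * ‖z‖ ^ (p - 3) : ℝ) : ℂ) * z ^ 2 * (starRingEnd ℂ) w)‖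
      ≤ C * ‖w‖ ^ p := by
  obtain ⟨hp1, hp2⟩ := hp
  refine ⟨3, by norm_num, fun z w hz => ?_⟩
  obtain ⟨a, rfl⟩ : ∃ a, p = a + 1 := ⟨p - 1, by ring⟩
  have ha : 0 < a := by linarith
  have ha1 : a ≤ 1 := by linarith
  have hr : 0 < ‖z‖ := norm_pos_iff.mpr hz
  have e1 : a + 1 - 1 = a := by ring
  have e3 : ‖z‖ ^ (a + 1 - 3) = ‖z‖ ^ a / ‖z‖ ^ 2 := by
    rw [show a + 1 - 3 = a - (2 : ℕ) by push_cast; ring, Real.rpow_sub_natCast hr.ne']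
  rw [e1, e3]
  set c : ℝ := (z * (starRingEnd ℂ) w).re with hcdef
  have hc : 2 * c = ‖z + w‖ ^ 2 - ‖z‖ ^ 2 - ‖w‖ ^ 2 := by
    have := Complex.normSq_add z w
    simp only [Complex.normSq_eq_norm_sq] at this
    linarith
  have hcabs : |c| ≤ ‖z‖ * ‖w‖ := by
    have := Complex.abs_re_le_norm (z * (starRingEnd ℂ) w)
    rwa [norm_mul, Complex.norm_conj] at this
  have hcC : (2 : ℂ) * (c : ℂ) = z * (starRingEnd ℂ) w + (starRingEnd ℂ) z * w := by
    have h := Complex.add_conj (z * (starRingEnd ℂ) w)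
    rw [map_mul, Complex.conj_conj] at h
    rw [h, hcdef]; push_cast; ring
  have hzz : z * (starRingEnd ℂ) z = (‖z‖ : ℂ) ^ 2 := Complex.mul_conj' z
  have hrC : (‖z‖ : ℂ) ≠ 0 := by exact_mod_cast hr.ne'
  have hE : ((‖z + w‖ ^ a : ℝ) * (z + w)
          - (‖z‖ ^ a : ℝ) * z
          - (((a + 1 + 1) / 2 * ‖z‖ ^ a : ℝ) : ℂ) * w
          - ((a / 2 * (‖z‖ ^ a / ‖z‖ ^ 2) : ℝ) : ℂ) * z ^ 2 * (starRingEnd ℂ) w)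
      = ((‖z + w‖ ^ a - ‖z‖ ^ a : ℝ) : ℂ) * (z + w)
        - ((a * (‖z‖ ^ a / ‖z‖ ^ 2) * c : ℝ) : ℂ) * z := by
    generalize ‖z + w‖ ^ a = S
    generalize ‖z‖ ^ a = R
    push_cast
    field_simp
    linear_combination (a * R * z : ℂ) * hcC + (a * R * w : ℂ) * hzz
  rw [hE]
  have hab : |‖z + w‖ - ‖z‖| ≤ ‖w‖ := by
    have := abs_norm_sub_norm_le (z + w) z
    simpa using this
  rw [Real.rpow_add_one' (norm_nonneg w) (by linarith)]
  have hD : |‖z + w‖ ^ a - ‖z‖ ^ a| ≤ ‖w‖ ^ a := by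
    rw [abs_le] at hab ⊢
    have h1 := aux_holder_le a ‖z + w‖ ‖z‖ ‖w‖ ha ha1 hr.le (norm_nonneg _) (norm_nonneg _)
      (by linarith)
    have h2 := aux_holder_le a ‖z‖ ‖z + w‖ ‖w‖ ha ha1 (norm_nonneg _) hr.le (norm_nonneg _)
      (by linarith)
    constructor <;> linarith
  have hR : 0 < ‖z‖ ^ a := Real.rpow_pos_of_pos hr a
  have hH : 0 ≤ ‖w‖ ^ a := Real.rpow_nonneg (norm_nonneg _) a
  rcases (norm_nonneg w).eq_or_lt with hw | hw
  · have hw0 : w = 0 := norm_eq_zero.mp hw.symm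
    have hc0 : c = 0 := by rw [hcdef, hw0]; simp
    rw [hc0, hw0]; simp
  rcases le_total ‖w‖ ‖z‖ with hle | hle
  · have hmain := aux_real a ‖z‖ ‖z + w‖ ‖w‖ c ha ha1 hr (norm_nonneg _) hw hle hab hc
    have e : ((‖z + w‖ ^ a - ‖z‖ ^ a : ℝ) : ℂ) * (z + w)
        - ((a * (‖z‖ ^ a / ‖z‖ ^ 2) * c : ℝ) : ℂ) * z
        = ((‖z + w‖ ^ a - ‖z‖ ^ a : ℝ) : ℂ) * w
        + ((‖z + w‖ ^ a - ‖z‖ ^ a - a * (‖z‖ ^ a / ‖z‖ ^ 2) * c : ℝ) : ℂ) * z := by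
      push_cast; ring
    rw [e]
    refine (norm_add_le _ _).trans ?_
    rw [norm_mul, norm_mul, Complex.norm_real, Complex.norm_real, Real.norm_eq_abs,
      Real.norm_eq_abs]
    have := mul_le_mul_of_nonneg_right hD hw.le
    have := mul_nonneg hH hw.le
    linarith
  · refine (norm_sub_le _ _).trans ?_
    rw [norm_mul, norm_mul, Complex.norm_real, Complex.norm_real, Real.norm_eq_abs,
      Real.norm_eq_abs]
    have h1 : |‖z + w‖ ^ a - ‖z‖ ^ a| * ‖z + w‖ ≤ ‖w‖ ^ a * (2 * ‖w‖) := by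
      have := norm_add_le z w
      gcongr
      linarith
    have h2 : |a * (‖z‖ ^ a / ‖z‖ ^ 2) * c| * ‖z‖ ≤ ‖w‖ ^ a * ‖w‖ := by
      have hRH : ‖z‖ ^ a ≤ ‖w‖ ^ a := Real.rpow_le_rpow hr.le hle ha.le
      rw [abs_mul, abs_of_pos (by positivity)]
      calc a * (‖z‖ ^ a / ‖z‖ ^ 2) * |c| * ‖z‖
          ≤ 1 * (‖z‖ ^ a / ‖z‖ ^ 2) * (‖z‖ * ‖w‖) * ‖z‖ := by gcongr
        _ = ‖z‖ ^ a * ‖w‖ := by field_simp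
        _ ≤ _ := by gcongr
    linarith
end
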